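/- For every η ∈ (0, 1/2] there exist ν > 0, τ > 0, and n₀ ∈ ℕ such that every graph G on n ≥ n₀ vertices with minimum degree δ(G) ≥ (1/2 + η)n is a robust (ν,τ)-expander. -/

import Mathlib

open Finset

namespace RPM

/-- The `ν`-robust neighbourhood of a vertex set `S` in a graph `G` on `n` vertices:
all vertices having at least `ν * n` neighbours in `S`. -/
def RN {V : Type*} [Fintype V] (G : SimpleGraph V) (ν : ℝ) (S : Set V) : Set V :=
  {v : V | ν * (Fintype.card V : ℝ) ≤ (Nat.card {u : V | u ∈ S ∧ G.Adj v u} : ℝ)}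

/-- `G` is a robust `(ν, τ)`-expander. -/
def RobustExpander {V : Type*} [Fintype V] (G : SimpleGraph V) (ν τ : ℝ) : Prop :=
  ∀ S : Set V,
    τ * (Fintype.card V : ℝ) ≤ (Nat.card S : ℝ) →
    (Nat.card S : ℝ) ≤ (1 - τ) * (Fintype.card V : ℝ) →
    (Nat.card S : ℝ) + ν * (Fintype.card V : ℝ) ≤ (Nat.card (RN G ν S) : ℝ)

/-- `M` (a set of edges) is a perfect matching of `G`: its edges are edges of `G`,
and every vertex lies in exactly one edge of `M` (in particular the edges are
pairwise disjoint and cover all vertices). -/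
def IsPM {V : Type*} (G : SimpleGraph V) (M : Finset (Sym2 V)) : Prop :=
  (∀ e ∈ M, e ∈ G.edgeSet) ∧ ∀ v : V, ∃! e, e ∈ M ∧ v ∈ e

/-- The number of perfect matchings of `G`. -/
noncomputable def pmCount {V : Type*} (G : SimpleGraph V) : ℕ :=
  Nat.card {M : Finset (Sym2 V) // IsPM G M}

/-- `N` (a set of edges) is a matching in `G`: edges of `G`, pairwise disjoint. -/
def IsMatchingIn {V : Type*} (G : SimpleGraph V) (N : Finset (Sym2 V)) : Prop :=
  (∀ e ∈ N, e ∈ G.edgeSet) ∧ ∀ e ∈ N, ∀ f ∈ N, e ≠ f → ∀ v : V, v ∈ e → v ∉ f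

/-- `G` is `d`-regular: every vertex has exactly `d` neighbours. -/
def RegularDeg {V : Type*} (G : SimpleGraph V) (d : ℕ) : Prop :=
  ∀ v : V, Nat.card {u : V | G.Adj v u} = d

/-- Probability that a uniformly random perfect matching of `G` contains the edge `e`. -/
noncomputable def edgeProb {V : Type*} (G : SimpleGraph V) (e : Sym2 V) : ℝ :=
  (Nat.card {M : Finset (Sym2 V) // IsPM G M ∧ e ∈ M} : ℝ) / (pmCount G : ℝ)

/-- `P[X = k]` where `X = |M ∩ N|` for a uniformly random perfect matching `M` of `G`. -/
noncomputable def interProb {V : Type*} [DecidableEq V] (G : SimpleGraph V)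
    (N : Finset (Sym2 V)) (k : ℕ) : ℝ :=
  (Nat.card {M : Finset (Sym2 V) // IsPM G M ∧ (M ∩ N).card = k} : ℝ) / (pmCount G : ℝ)

/-- The Poisson probability mass function with parameter `lam`. -/
noncomputable def poissonPMF (lam : ℝ) (k : ℕ) : ℝ :=
  Real.exp (-lam) * lam ^ k / (Nat.factorial k)

lemma natCard_setOf {V : Type*} [Fintype V] (p : V → Prop) [DecidablePred p] :
    Nat.card {u : V | p u} = #{u | p u} := by
  rw [Set.coe_ofPred, Nat.card_eq_fintype_card, Fintype.card_subtype]

open Classical in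
/-- A vertex of degree `d` has at least `|S| + d - n` neighbours in `S`. -/
lemma card_add_degree_le {V : Type*} [Fintype V] (G : SimpleGraph V) (S : Finset V) (v : V) :
    #S + #{u | G.Adj v u} ≤ Fintype.card V + #{u ∈ S | G.Adj v u} := by
  have h : S ∩ ({u | G.Adj v u} : Finset V) = {u ∈ S | G.Adj v u} := by
    ext u
    simp
  rw [← card_union_add_card_inter, h]
  exact Nat.add_le_add_right (card_le_univ _) _

open Classical in
/-- Double counting of the edges meeting `S`, split according to whether a vertex has at least
`k` neighbours in `S`. -/
lemma sum_degree_le {V : Type*} [Fintype V] (G : SimpleGraph V) (S : Finset V) {k : ℝ}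
    (hk : 0 ≤ k) :
    ∑ u ∈ S, (#{v | G.Adj u v} : ℝ) ≤
      #{v | k ≤ (#{u ∈ S | G.Adj v u} : ℝ)} * #S + Fintype.card V * k := by
  have hcount : ∑ u ∈ S, #{v | G.Adj u v} = ∑ v, #{u ∈ S | G.Adj v u} := by
    simpa [bipartiteAbove, bipartiteBelow, G.adj_comm] using
      sum_card_bipartiteAbove_eq_sum_card_bipartiteBelow (s := S) (t := univ) G.Adj
  have hv (v : V) : (#{u ∈ S | G.Adj v u} : ℝ) ≤
      (if k ≤ (#{u ∈ S | G.Adj v u} : ℝ) then (#S : ℝ) else 0) + k := by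
    split_ifs with h
    · have : (#{u ∈ S | G.Adj v u} : ℝ) ≤ #S := by exact_mod_cast card_filter_le _ _
      linarith
    · linarith
  calc ∑ u ∈ S, (#{v | G.Adj u v} : ℝ) = ∑ v, (#{u ∈ S | G.Adj v u} : ℝ) := by
        exact_mod_cast hcount
    _ ≤ ∑ v, ((if k ≤ (#{u ∈ S | G.Adj v u} : ℝ) then (#S : ℝ) else 0) + k) :=
        sum_le_sum fun v _ => hv v
    _ = _ := by
        rw [sum_add_distrib, ← sum_filter]
        simp

/-- Minimum degree at least `(1/2 + η)n` forces robust `(ητ/2, τ)`-expansion for every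
`τ ∈ (0, 1]`. -/
theorem robustExpander_of_min_degree {V : Type*} [Fintype V] (G : SimpleGraph V) {η τ : ℝ}
    (hη : 0 < η) (hη' : η ≤ 1 / 2) (hτ : 0 < τ) (hτ' : τ ≤ 1)
    (hdeg : ∀ v : V,
      (1 / 2 + η) * (Fintype.card V : ℝ) ≤ (Nat.card {u : V | G.Adj v u} : ℝ)) :
    RobustExpander G (η * τ / 2) τ := by
  classical
  intro S hS hS'
  have hRN : Nat.card (RN G (η * τ / 2) S) =
      #{v | η * τ / 2 * Fintype.card V ≤ (#{u ∈ S.toFinset | G.Adj v u} : ℝ)} := by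
    rw [RN, natCard_setOf]
    congr! 5 with v
    rw [natCard_setOf]
    congr 1
    ext u
    simp
  have hcard : Nat.card S = #S.toFinset := by
    rw [Nat.card_eq_fintype_card, Set.toFinset_card]
  simp only [natCard_setOf] at hdeg
  rw [hRN]
  rw [hcard] at hS hS' ⊢
  generalize S.toFinset = T at hS hS' ⊢
  set n : ℝ := (Fintype.card V : ℝ) with hn
  have hn0 : 0 ≤ n := Nat.cast_nonneg _
  have hητ : η * τ ≤ η := mul_le_of_le_one_right hη.le hτ'
  have hητ' : η * τ ≤ τ := mul_le_of_le_one_left hτ.le (by linarith)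
  by_cases hhalf : n / 2 ≤ #T
  · have hall : ({v | η * τ / 2 * n ≤ (#{u ∈ T | G.Adj v u} : ℝ)} : Finset V) = univ := by
      refine filter_true_of_mem fun v _ => ?_
      have h : (#T : ℝ) + #{u | G.Adj v u} ≤ n + #{u ∈ T | G.Adj v u} := by
        rw [hn]; exact_mod_cast card_add_degree_le G T v
      nlinarith [hdeg v, mul_pos hη hτ]
    rw [hall, card_univ, ← hn]
    nlinarith [mul_pos hη hτ]
  · obtain hn1 | hn1 := hn0.eq_or_lt
    · have : (0 : ℝ) ≤ #T := Nat.cast_nonneg _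
      linarith
    have hT : (0 : ℝ) < #T := (mul_pos hτ hn1).trans_le hS
    have hlow : #T * ((1 / 2 + η) * n) ≤ ∑ u ∈ T, (#{v | G.Adj u v} : ℝ) := by
      simpa using card_nsmul_le_sum T (fun u => (#{v | G.Adj u v} : ℝ)) _ fun u _ => hdeg u
    have hup := hlow.trans (sum_degree_le G T (k := η * τ / 2 * n) (by positivity))
    have herr : n * (η * τ / 2 * n) ≤ η / 2 * n * #T := by
      calc n * (η * τ / 2 * n) = η / 2 * n * (τ * n) := by ring
        _ ≤ _ := by gcongr
    have hR : (1 / 2 + η) * n - η / 2 * n ≤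
        #{v | η * τ / 2 * n ≤ (#{u ∈ T | G.Adj v u} : ℝ)} := by
      refine le_of_mul_le_mul_right ?_ hT
      linarith
    have : η * τ / 2 * n ≤ η / 2 * n := by gcongr
    linarith

/-- Graphs on `n` vertices with minimum degree at least `(1/2 + η)n`
are robust `(ν,τ)`-expanders for suitable `ν, τ > 0` and `n` large. -/
theorem min_degree_implies_robust_expander :
    ∀ η : ℝ, 0 < η → η ≤ 1 / 2 →
    ∃ ν τ : ℝ, 0 < ν ∧ 0 < τ ∧
    ∃ n₀ : ℕ,
    ∀ (V : Type) [Fintype V], n₀ ≤ Fintype.card V →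
    ∀ G : SimpleGraph V,
      (∀ v : V, (1 / 2 + η) * (Fintype.card V : ℝ) ≤ (Nat.card {u : V | G.Adj v u} : ℝ)) →
      RobustExpander G ν τ := by
  intro η hη hη'
  exact ⟨η * η / 2, η, by positivity, hη, 0, fun V _ _ G hdeg =>
    robustExpander_of_min_degree G hη hη' hη (by linarith) hdeg⟩

end RPM
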